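/- arXiv:2510.25403 — 3 statements merged into one kernel-verified Lean document; each statement's English description precedes it below -/
import Mathlib

section
/- Let G be a finite non-cyclic group with identity e. Then N_e = 2 if G is a generalized quaternion group of order 2^n (n ≥ 3), and N_e = 1 otherwise. -/
def padj {G : Type*} [Group G] (a b : G) : Prop :=
  a ≠ b ∧ (Subgroup.zpowers a ≤ Subgroup.zpowers b ∨ Subgroup.zpowers b ≤ Subgroup.zpowers a)

def pnbhd {G : Type*} [Group G] (a : G) : Set G := {x | padj a x}

def closedTwins {G : Type*} [Group G] (a : G) : Set G :=
  {b | padj a b ∧ pnbhd a \ {b} = pnbhd b \ {a}}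

noncomputable def Ncount {G : Type*} [Group G] (a : G) : ℕ := (closedTwins a).ncard + 1

def eadj {G : Type*} [Group G] (a b : G) : Prop :=
  a ≠ b ∧ ∃ c : G, a ∈ Subgroup.zpowers c ∧ b ∈ Subgroup.zpowers c

theorem aux_conj {G : Type*} [Group G] {a x : G} {u : ℤ} (h : x * a * x⁻¹ = a ^ u) (i : ℤ) :
    x * a ^ i = a ^ (u * i) * x := by
  have : x * a ^ i * x⁻¹ = a ^ (u * i) := by
    rw [← conj_zpow, h, zpow_mul]
  rw [← this]; group

theorem aux_pow {G : Type*} [Group G] {a x : G} {u : ℤ} (h : x * a * x⁻¹ = a ^ u) (i : ℤ) (k : ℕ) :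
    (a ^ i * x) ^ k = a ^ (i * ∑ t ∈ Finset.range k, u ^ t) * x ^ k := by
  induction k with
  | zero => simp
  | succ k ih =>
    rw [pow_succ' (a ^ i * x), ih, geom_sum_succ, pow_succ' x]
    have := aux_conj h (i * ∑ t ∈ Finset.range k, u ^ t)
    calc a ^ i * x * (a ^ (i * ∑ t ∈ Finset.range k, u ^ t) * x ^ k)
        = a ^ i * (x * a ^ (i * ∑ t ∈ Finset.range k, u ^ t)) * x ^ k := by group
      _ = _ := by rw [this, ← mul_assoc, ← zpow_add, mul_assoc]; congr 2; ring

theorem aux_conj_pow {G : Type*} [Group G] {a x : G} {u : ℤ} (h : x * a * x⁻¹ = a ^ u) (k : ℕ) :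
    x ^ k * a * (x ^ k)⁻¹ = a ^ (u ^ k) := by
  induction k with
  | zero => simp
  | succ k ih =>
    have e : x ^ (k + 1) * a * (x ^ (k + 1))⁻¹ = x * (x ^ k * a * (x ^ k)⁻¹) * x⁻¹ := by
      rw [pow_succ']; group
    rw [e, ih, aux_conj h, pow_succ']; group

theorem aux_dvd {G : Type*} [Group G] {a : G} {p n : ℕ} (ha : orderOf a = p ^ n) (k : ℤ) :
    a ^ k = 1 ↔ (p : ℤ) ^ n ∣ k := by
  rw [← orderOf_dvd_iff_zpow_eq_one, ha]; push_cast; rfl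

theorem aux_gen {G : Type*} [Group G] {a : G} {p n : ℕ} (hp : p.Prime) (ha : orderOf a = p ^ n)
    {j : ℤ} (hj : ¬ (p : ℤ) ∣ j) : a ∈ Subgroup.zpowers (a ^ j) := by
  have hc : IsCoprime j ((p : ℤ) ^ n) :=
    (((Nat.prime_iff_prime_int.mp hp).coprime_iff_not_dvd.mpr hj).pow_left).symm
  obtain ⟨r, s, hrs⟩ := hc
  refine ⟨r, ?_⟩
  show (a ^ j) ^ r = a
  rw [← zpow_mul]
  have : a ^ (j * r - 1) = 1 := (aux_dvd ha _).2 ⟨-s, by linarith⟩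
  rw [zpow_sub_one, mul_inv_eq_one] at this
  exact this

theorem aux_nosol {G : Type*} [Group G] {a x : G} {u : ℤ} (h : x * a * x⁻¹ = a ^ u) {p n : ℕ}
    (ha : orderOf a = p ^ n) (hx : x ∉ Subgroup.zpowers a) {j : ℤ} (hj : x ^ p = a ^ j)
    (hun : ∀ g : G, g ^ p = 1 → g ∈ Subgroup.zpowers a) (i : ℤ) :
    ¬ (p : ℤ) ^ n ∣ i * (∑ t ∈ Finset.range p, u ^ t) + j := by
  intro hd
  have h1 := aux_pow h i p
  rw [hj, ← zpow_add, (aux_dvd ha _).2 hd] at h1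
  have h2 := hun _ h1
  rw [Subgroup.mul_mem_cancel_left _ (Subgroup.zpow_mem _ (Subgroup.mem_zpowers a) i)] at h2
  exact hx h2

theorem aux_nosol' {G : Type*} [Group G] {a x : G} {u : ℤ} (h : x * a * x⁻¹ = a ^ u) {p n : ℕ}
    (hp : p.Prime)
    (ha : orderOf a = p ^ n) (hx : x ∉ Subgroup.zpowers a) {j : ℤ} (hj : x ^ p = a ^ j)
    (hun : ∀ g : G, g ^ p = 1 → g ∈ Subgroup.zpowers a) (hpj : (p : ℤ) ∣ j) {s : ℤ}
    (hs : ∑ t ∈ Finset.range p, u ^ t = p * s) : (p : ℤ) ∣ s := by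
  by_contra hc
  have hc : IsCoprime s ((p : ℤ) ^ n) :=
    (((Nat.prime_iff_prime_int.mp hp).coprime_iff_not_dvd.mpr hc).pow_left).symm
  obtain ⟨r, t, hrt⟩ := hc
  obtain ⟨j', rfl⟩ := hpj
  apply aux_nosol h ha hx hj hun (-(r * j'))
  rw [hs]
  exact ⟨p * j' * t, by linear_combination (-(p:ℤ)*j') * hrt⟩

theorem aux_comm {G : Type*} [Group G] {a x : G} {p n : ℕ} (hp : p.Prime)
    (ha : orderOf a = p ^ n) (hx : x ∉ Subgroup.zpowers a) (hxp : x ^ p ∈ Subgroup.zpowers a)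
    (hun : ∀ g : G, g ^ p = 1 → g ∈ Subgroup.zpowers a) (hc : x * a = a * x) :
    a ∈ Subgroup.zpowers x := by
  obtain ⟨j, hj⟩ := hxp
  have hj : x ^ p = a ^ j := hj.symm
  have h : x * a * x⁻¹ = a ^ (1 : ℤ) := by rw [hc]; group
  by_cases hpj : (p : ℤ) ∣ j
  · have := aux_nosol' h hp ha hx hj hun hpj (s := 1) (by simp)
    exact absurd this (Nat.prime_iff_prime_int.mp hp).not_dvd_one
  · have h1 := aux_gen hp ha hpj
    rw [← hj] at h1
    exact (Subgroup.zpowers_le.2 (Subgroup.pow_mem _ (Subgroup.mem_zpowers x) p)) h1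

theorem aux_key {G : Type*} [Group G] {a x : G} {u : ℤ} (h : x * a * x⁻¹ = a ^ u) {p n : ℕ}
    (hp : p.Prime)
    (ha : orderOf a = p ^ n) (hx : x ∉ Subgroup.zpowers a) (hxp : x ^ p ∈ Subgroup.zpowers a)
    (hun : ∀ g : G, g ^ p = 1 → g ∈ Subgroup.zpowers a) (hc : x * a ≠ a * x) :
    p = 2 ∧ 2 ≤ n ∧ x * a * x⁻¹ = a⁻¹ ∧ x ^ 2 = a ^ (2 ^ (n - 1)) := by
  have hpi := Nat.prime_iff_prime_int.mp hp
  obtain ⟨j, hj⟩ := hxp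
  have hj : x ^ p = a ^ j := hj.symm
  have hpj : (p : ℤ) ∣ j := by
    by_contra hpj
    have h1 := aux_gen hp ha hpj
    rw [← hj] at h1
    obtain ⟨r, hr⟩ := h1
    have hr : (x ^ p) ^ r = a := hr
    apply hc
    rw [← hr]
    exact ((Commute.refl x).pow_right p).zpow_right r
  have hu1 : ¬ (p : ℤ) ^ n ∣ u - 1 := by
    intro hd
    rw [← aux_dvd ha, zpow_sub_one, mul_inv_eq_one] at hd
    rw [hd, mul_inv_eq_iff_eq_mul] at h
    exact hc h
  have hup : (p : ℤ) ^ n ∣ u ^ p - 1 := by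
    rw [← aux_dvd ha, zpow_sub_one, mul_inv_eq_one, ← aux_conj_pow h, hj]
    group
  have hju : (p : ℤ) ^ n ∣ u * j - j := by
    rw [← aux_dvd ha, zpow_sub, mul_inv_eq_one]
    have := aux_conj h j
    rw [← hj, ← pow_succ', pow_succ, mul_left_inj] at this
    rw [← this, hj]
  have hn : n ≠ 0 := by
    rintro rfl
    simp at hu1
  have hpu : (p : ℤ) ∣ u - 1 := by
    have h1 : (p : ℤ) ∣ u ^ p - 1 := (dvd_pow_self _ hn).trans hup
    have : Fact p.Prime := ⟨hp⟩
    rw [← ZMod.intCast_zmod_eq_zero_iff_dvd] at h1 ⊢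
    push_cast at h1 ⊢
    rwa [ZMod.pow_card] at h1
  have hn2 : 2 ≤ n := by
    by_contra hlt
    have : n = 1 := by omega
    subst this
    rw [pow_one] at hu1
    exact hu1 hpu
  have hp2 : p = 2 := by
    rcases hp.eq_two_or_odd' with h2 | hodd
    · exact h2
    exfalso
    obtain ⟨k, hk⟩ := hpu
    have := odd_sq_dvd_geom_sum₂_sub (R := ℤ) 1 k hodd
    obtain ⟨l, hl⟩ := this
    have hu : u = 1 + p * k := by linarith
    have hs : ∑ t ∈ Finset.range p, u ^ t = p * (1 + p * l) := by
      simp only [one_pow, mul_one] at hl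
      rw [hu]
      linear_combination hl
    have h3 := aux_nosol' h hp ha hx hj hun hpj hs
    have h4 : (p : ℤ) ∣ 1 := (Int.dvd_add_left (Dvd.intro _ rfl)).1 h3
    exact hpi.not_dvd_one h4
  subst hp2
  refine ⟨rfl, hn2, ?_⟩
  obtain ⟨m, rfl⟩ : ∃ m, n = m + 1 := ⟨n - 1, by omega⟩
  obtain ⟨k, hk⟩ := hpu
  push_cast at *
  have hs : ∑ t ∈ Finset.range 2, u ^ t = 2 * (1 + k) := by
    simp [Finset.sum_range_succ]; linarith
  have h3 : (2 : ℤ) ∣ 1 + k := by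
    simpa using aux_nosol' h hp ha hx hj hun (by simpa using hpj) (by simpa using hs)
  have hkodd : IsCoprime ((2 : ℤ) ^ m) k := by
    apply IsCoprime.pow_left
    rw [Prime.coprime_iff_not_dvd Int.prime_two]
    omega
  have hj' : (2 : ℤ) ^ m ∣ j := by
    have : (2 : ℤ) ^ m * 2 ∣ (k * j) * 2 := by
      rw [← pow_succ]; convert hju using 1; linear_combination (-j) * hk
    exact hkodd.dvd_of_dvd_mul_left (Int.dvd_of_mul_dvd_mul_right two_ne_zero this)
  have hk' : (2 : ℤ) ^ m ∣ 2 * (1 + k) := by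
    have : (2 : ℤ) ^ m * 2 ∣ (k * (2 * (1 + k))) * 2 := by
      rw [← pow_succ]; convert hup using 1
      have : u = 1 + 2 * k := by linarith
      rw [this]; ring
    exact hkodd.dvd_of_dvd_mul_left (Int.dvd_of_mul_dvd_mul_right two_ne_zero this)
  obtain ⟨c, hc'⟩ := hj'
  obtain ⟨d, hd⟩ := hk'
  have hns := fun i => aux_nosol h ha hx hj hun i
  rw [hs, hd] at hns
  push_cast at hns
  have hcodd : ¬ (2 : ℤ) ∣ c := by
    rintro ⟨e, rfl⟩
    apply hns 0
    exact ⟨e, by rw [hc']; ring⟩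
  have hdeven : (2 : ℤ) ∣ d := by
    by_contra hdo
    obtain ⟨e, he⟩ : (2 : ℤ) ∣ d + c := by omega
    apply hns 1
    exact ⟨e, by rw [hc', pow_succ]; linear_combination (2:ℤ)^m * he⟩
  constructor
  · rw [h]
    obtain ⟨e, rfl⟩ := hdeven
    rw [← mul_eq_one_iff_eq_inv, ← zpow_add_one, aux_dvd ha]
    push_cast
    exact ⟨e, by rw [pow_succ]; linear_combination hk + hd⟩
  · rw [hj, ← zpow_natCast, ← mul_inv_eq_one, ← zpow_sub, aux_dvd ha]
    obtain ⟨e, he⟩ : (2 : ℤ) ∣ c - 1 := by omega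
    push_cast
    exact ⟨e, by rw [hc', pow_succ]; linear_combination (2:ℤ)^m * he⟩

theorem aux_quat {G : Type*} [Group G] {a x : G} {N : ℕ} [NeZero N] (ha : orderOf a = 2 * N)
    (hx : x ∉ Subgroup.zpowers a) (hinv : x * a * x⁻¹ = a⁻¹) (hsq : x ^ 2 = a ^ N)
    (hall : ∀ y, y ∉ Subgroup.zpowers a → x⁻¹ * y ∈ Subgroup.zpowers a) :
    Nonempty (G ≃* QuaternionGroup N) := by
  let φ : ZMod (2 * N) →+ Additive G := ZMod.lift (2 * N)
    ⟨zmultiplesHom (Additive G) (Additive.ofMul a), by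
      rw [zmultiplesHom_apply, ← ofMul_zpow, zpow_natCast, ← ha, pow_orderOf_eq_one]; rfl⟩
  let E : ZMod (2 * N) → G := fun i => (φ i).toMul
  have hE : ∀ k : ℤ, E (k : ZMod (2 * N)) = a ^ k := by
    intro k
    simp only [E, φ, ZMod.lift_coe, zmultiplesHom_apply]
    rfl
  have hadd : ∀ i j, E (i + j) = E i * E j := by
    intro i j; simp [E]
  have hx' : x * a * x⁻¹ = a ^ (-1 : ℤ) := by rw [hinv]; group
  have hEx : ∀ i, E i * x = x * E (-i) := by
    intro i
    obtain ⟨k, rfl⟩ := ZMod.intCast_surjective i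
    rw [← Int.cast_neg, hE, hE, aux_conj hx']
    simp
  have hEN : E (N : ZMod (2 * N)) = a ^ N := by
    have := hE N
    simpa using this
  have hinj : ∀ i j, E i = E j → i = j := by
    intro i j hij
    obtain ⟨k, rfl⟩ := ZMod.intCast_surjective i
    obtain ⟨l, rfl⟩ := ZMod.intCast_surjective j
    rw [hE, hE, ← mul_inv_eq_one, ← zpow_sub, ← orderOf_dvd_iff_zpow_eq_one, ha] at hij
    rw [← sub_eq_zero, ← Int.cast_sub]
    exact (ZMod.intCast_zmod_eq_zero_iff_dvd _ _).2 hij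
  have hmem : ∀ i, E i ∈ Subgroup.zpowers a := by
    intro i
    obtain ⟨k, rfl⟩ := ZMod.intCast_surjective i
    rw [hE]; exact ⟨k, rfl⟩
  let f : QuaternionGroup N → G := fun q => match q with
    | .a i => E i
    | .xa i => x * E i
  have hf1 : ∀ i, f (.a i) = E i := fun _ => rfl
  have hf2 : ∀ i, f (.xa i) = x * E i := fun _ => rfl
  have hmul : ∀ q r, f (q * r) = f q * f r := by
    rintro (i | i) (j | j)
    · rw [QuaternionGroup.a_mul_a, hf1, hf1, hf1, hadd]
    · rw [QuaternionGroup.a_mul_xa, hf1, hf2, hf2, ← mul_assoc, hEx, mul_assoc, ← hadd]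
      congr 2; ring
    · rw [QuaternionGroup.xa_mul_a, hf1, hf2, hf2, hadd, mul_assoc]
    · rw [QuaternionGroup.xa_mul_xa, hf1, hf2, hf2, mul_assoc, ← mul_assoc (E i), hEx,
        mul_assoc, ← hadd, ← mul_assoc, ← sq, hsq, ← hEN, ← hadd]
      congr 1; ring
  refine ⟨(MulEquiv.ofBijective (MonoidHom.mk' f hmul) ⟨?_, ?_⟩).symm⟩
  · rintro (i | i) (j | j) hij
    · rw [hinj i j hij]
    · exfalso
      have hij : E i = x * E j := hij
      apply hx
      rw [← Subgroup.mul_mem_cancel_right _ (hmem j), ← hij]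
      exact hmem i
    · exfalso
      have hij : x * E i = E j := hij
      apply hx
      rw [← Subgroup.mul_mem_cancel_right _ (hmem i), hij]
      exact hmem j
    · have hij : x * E i = x * E j := hij
      rw [hinj i j (mul_left_cancel hij)]
  · intro y
    by_cases hy : y ∈ Subgroup.zpowers a
    · obtain ⟨k, hk⟩ := hy
      exact ⟨.a (k : ZMod (2 * N)), (hE k).trans hk⟩
    · obtain ⟨k, hk⟩ := hall y hy
      have hk : a ^ k = x⁻¹ * y := hk
      refine ⟨.xa (k : ZMod (2 * N)), ?_⟩
      show x * E _ = y
      rw [hE, hk]; group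

theorem aux_center {H : Type*} [Group H] [Finite H] {p : ℕ} [Fact p.Prime] (hH : IsPGroup p H)
    (N : Subgroup H) [N.Normal] (hN : N ≠ ⊥) : ∃ x ∈ N, x ≠ 1 ∧ ∀ g, g * x = x * g := by
  have hd : p ∣ Nat.card N := by
    have : Nontrivial N := (Subgroup.nontrivial_iff_ne_bot N).2 hN
    obtain ⟨n, hn0, hn⟩ := (hH.to_subgroup N).nontrivial_iff_card.mp inferInstance
    exact hn.symm ▸ dvd_pow_self _ (ne_of_gt hn0)
  obtain ⟨b, hb, hne⟩ := (hH.of_equiv ConjAct.toConjAct).exists_fixed_point_of_prime_dvd_card_of_fixed_point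
    N hd (a := 1) (fun g => by simp)
  refine ⟨b, b.2, fun h => hne (Subtype.ext h.symm), fun g => ?_⟩
  have := congrArg Subtype.val (hb (ConjAct.toConjAct g))
  rw [ConjAct.Subgroup.val_conj_smul, ConjAct.smul_def, ConjAct.ofConjAct_toConjAct,
    mul_inv_eq_iff_eq_mul] at this
  exact this

theorem aux_descend {G : Type*} [Group G] {p : ℕ} (hG : IsPGroup p G) (A : Subgroup G) {y : G}
    (hy : y ∉ A) : ∃ t, y ^ p ^ t ∉ A ∧ (y ^ p ^ t) ^ p ∈ A := by
  classical
  have hex : ∃ k, y ^ p ^ k ∈ A := by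
    obtain ⟨k, hk⟩ := hG y
    exact ⟨k, hk ▸ A.one_mem⟩
  have h0 : Nat.find hex ≠ 0 := by
    intro h
    have := Nat.find_spec hex
    rw [h] at this
    simp at this
    exact hy this
  refine ⟨Nat.find hex - 1, Nat.find_min hex (by omega), ?_⟩
  rw [← pow_mul, ← pow_succ, Nat.sub_add_cancel (by omega)]
  exact Nat.find_spec hex

theorem aux_main {G : Type*} [Group G] [Finite G] {p : ℕ} [hpf : Fact p.Prime] (hG : IsPGroup p G)
    (huniq : ∀ g w : G, orderOf w = p → g ^ p = 1 → g ∈ Subgroup.zpowers w)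
    (hnc : ¬ IsCyclic G) : ∃ n : ℕ, 3 ≤ n ∧ Nonempty (G ≃* QuaternionGroup (2 ^ (n - 2))) := by
  have hp : p.Prime := hpf.out
  have : Nontrivial G := by
    by_contra hn
    rw [not_nontrivial_iff_subsingleton] at hn
    exact hnc inferInstance
  have : Nonempty {a : G // (Subgroup.zpowers a).Normal} :=
    ⟨⟨1, by rw [Subgroup.zpowers_one_eq_bot]; infer_instance⟩⟩
  obtain ⟨⟨a, hnorm⟩, hmax⟩ := Finite.exists_max
    (fun a : {a : G // (Subgroup.zpowers a).Normal} => orderOf a.1)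
  have hmax : ∀ b : G, (Subgroup.zpowers b).Normal → orderOf b ≤ orderOf a :=
    fun b hb => hmax ⟨b, hb⟩
  obtain ⟨n, ha⟩ := IsPGroup.iff_orderOf.1 hG a
  have hn0 : n ≠ 0 := by
    rintro rfl
    obtain ⟨c, -, hc1, hc⟩ := aux_center hG (⊤ : Subgroup G) top_ne_bot
    have h1 : (Subgroup.zpowers c).Normal := by
      constructor
      rintro _ ⟨k, rfl⟩ g
      refine ⟨k, ?_⟩
      show c ^ k = g * c ^ k * g⁻¹
      have : Commute g c := hc g
      rw [(this.zpow_right k).eq]; group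
    have h2 := hmax c h1
    rw [ha, pow_zero] at h2
    have h3 := orderOf_pos c
    exact hc1 (orderOf_eq_one_iff.1 (by omega))
  have hun : ∀ g : G, g ^ p = 1 → g ∈ Subgroup.zpowers a := by
    intro g hg
    have h1 : orderOf (a ^ p ^ (n - 1)) = p := by
      rw [orderOf_pow_of_dvd (pow_ne_zero _ hp.ne_zero) (by rw [ha]; exact pow_dvd_pow _ (by omega)),
        ha, Nat.pow_div (by omega) hp.pos, show n - (n - 1) = 1 by omega, pow_one]
    exact (Subgroup.zpowers_le.2 (Subgroup.pow_mem _ (Subgroup.mem_zpowers a) _))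
      (huniq g _ h1 hg)
  have hconj : ∀ x : G, ∃ u : ℤ, x * a * x⁻¹ = a ^ u := by
    intro x
    obtain ⟨u, hu⟩ := hnorm.conj_mem a (Subgroup.mem_zpowers a) x
    exact ⟨u, hu.symm⟩
  have hcent : ∀ y : G, y * a = a * y → y ∈ Subgroup.zpowers a := by
    by_contra! hcon
    obtain ⟨y, hya, hy⟩ := hcon
    set A := Subgroup.zpowers a with hA
    let C := Subgroup.centralizer (A : Set G)
    have hCn : C.Normal := inferInstance
    let π := QuotientGroup.mk' A
    have hmC : ∀ z : G, z ∈ C ↔ z * a = a * z := by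
      intro z
      simp only [C, hA]
      rw [Subgroup.mem_centralizer_iff]
      constructor
      · intro h; exact (h a (Subgroup.mem_zpowers a)).symm
      · rintro h _ ⟨k, rfl⟩
        have : Commute z a := h
        exact (this.zpow_right k).eq.symm
    have hN : (C.map π).Normal := hCn.map π (QuotientGroup.mk'_surjective A)
    obtain ⟨q, hqC, hq1, hqc⟩ := aux_center (hG.to_quotient A) (C.map π) (by
      intro hb
      have : π y ∈ C.map π := ⟨y, (hmC y).2 hya, rfl⟩
      rw [hb, Subgroup.mem_bot] at this
      exact hy ((QuotientGroup.eq_one_iff y).1 this))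
    obtain ⟨w, hwC, rfl⟩ := hqC
    have hwA : w ∉ A := fun h => hq1 ((QuotientGroup.eq_one_iff w).2 h)
    obtain ⟨t, ht1, ht2⟩ := aux_descend hG A hwA
    set v := w ^ p ^ t with hv
    have hvC : v * a = a * v := (hmC v).1 (C.pow_mem hwC _)
    have hav := aux_comm hp ha ht1 ht2 hun hvC
    have hvn : (Subgroup.zpowers v).Normal := by
      have hle : A ≤ Subgroup.zpowers v := Subgroup.zpowers_le.2 hav
      have hgv : ∀ g, g * v * g⁻¹ ∈ Subgroup.zpowers v := by
        intro g
        have h1 : π (g * v * g⁻¹ * v⁻¹) = 1 := by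
          have : Commute (π g) (π v) := by
            rw [hv, map_pow]
            exact Commute.pow_right (hqc (π g)) _
          rw [map_mul, map_mul, map_mul, this.eq, map_inv, map_inv]; group
        have h2 := hle ((QuotientGroup.eq_one_iff _).1 h1)
        rwa [Subgroup.mul_mem_cancel_right _ (Subgroup.inv_mem _ (Subgroup.mem_zpowers v))] at h2
      constructor
      rintro _ ⟨k, rfl⟩ g
      show g * v ^ k * g⁻¹ ∈ _
      rw [← conj_zpow]
      exact Subgroup.zpow_mem _ (hgv g) k
    have hle := hmax v hvn
    have heq : A = Subgroup.zpowers v := by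
      apply Subgroup.eq_of_le_of_card_ge (Subgroup.zpowers_le.2 hav)
      rw [Nat.card_zpowers, Nat.card_zpowers]
      exact hle
    exact ht1 (heq ▸ Subgroup.mem_zpowers v)
  have hkey : ∀ x, x ∉ Subgroup.zpowers a → x ^ p ∈ Subgroup.zpowers a →
      p = 2 ∧ 2 ≤ n ∧ x * a * x⁻¹ = a⁻¹ ∧ x ^ 2 = a ^ (2 ^ (n - 1)) := by
    intro x hx hxp
    obtain ⟨u, hu⟩ := hconj x
    exact aux_key hu hp ha hx hxp hun (fun h => hx (hcent x h))
  obtain ⟨y, hy⟩ : ∃ y, y ∉ Subgroup.zpowers a := by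
    by_contra! hcon
    exact hnc ⟨a, hcon⟩
  obtain ⟨t, ht1, ht2⟩ := aux_descend hG _ hy
  set x := y ^ p ^ t
  obtain ⟨hp2, hn2, hinv, hsq⟩ := hkey x ht1 ht2
  subst hp2
  have hallinv : ∀ z, z ∉ Subgroup.zpowers a → z * a * z⁻¹ = a⁻¹ := by
    intro z hz
    obtain ⟨s, hs1, hs2⟩ := aux_descend hG _ hz
    obtain ⟨-, -, hi, -⟩ := hkey _ hs1 hs2
    rcases s with _ | s
    · simpa using hi
    exfalso
    obtain ⟨u, hu⟩ := hconj (z ^ 2 ^ s)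
    have h1 := aux_conj_pow hu 2
    rw [← pow_mul, ← pow_succ, hi, eq_comm, ← mul_eq_one_iff_eq_inv, ← zpow_add_one,
      aux_dvd ha] at h1
    have h2 : (4 : ℤ) ∣ u ^ 2 + 1 := by
      refine dvd_trans ?_ h1
      have := pow_dvd_pow (2 : ℤ) hn2
      push_cast
      simpa using this
    rcases Int.even_or_odd' u with ⟨c, rfl | rfl⟩ <;> ring_nf at h2 <;> omega
  refine ⟨n + 1, by omega, ?_⟩
  have : NeZero (2 ^ (n + 1 - 2)) := ⟨by positivity⟩
  have hexp : n + 1 - 2 = n - 1 := by omega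
  refine aux_quat (x := x) (a := a) ?_ ht1 hinv (by rw [hsq, hexp]) ?_
  · rw [ha, hexp, ← pow_succ']; congr 1; omega
  · intro z hz
    apply hcent
    have h1 := hallinv z hz
    have h2 : x⁻¹ * a⁻¹ * x = a := by rw [← hinv]; group
    have h3 : (x⁻¹ * z) * a * (x⁻¹ * z)⁻¹ = a := by
      calc (x⁻¹ * z) * a * (x⁻¹ * z)⁻¹ = x⁻¹ * (z * a * z⁻¹) * x := by group
        _ = a := by rw [h1, h2]
    rwa [mul_inv_eq_iff_eq_mul] at h3

theorem aux_twins {G : Type*} [Group G] : closedTwins (1 : G) =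
    {b | b ≠ 1 ∧ ∀ y : G, y ∈ Subgroup.zpowers b ∨ b ∈ Subgroup.zpowers y} := by
  ext b
  simp only [closedTwins, pnbhd, padj, Set.mem_ofPred_eq, Subgroup.zpowers_le,
    Subgroup.one_mem, true_or, and_true]
  constructor
  · rintro ⟨hb, h⟩
    refine ⟨hb.symm, fun y => ?_⟩
    by_cases hy1 : y = 1
    · left; rw [hy1]; exact Subgroup.one_mem _
    by_cases hyb : y = b
    · left; rw [hyb]; exact Subgroup.mem_zpowers b
    have : y ∈ ({x | (1 : G) ≠ x} \ {b} : Set G) := ⟨Ne.symm hy1, hyb⟩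
    rw [h] at this
    exact this.1.2.symm
  · rintro ⟨hb, h⟩
    refine ⟨hb.symm, ?_⟩
    ext y
    simp only [Set.mem_sdiff, Set.mem_ofPred_eq, Set.mem_singleton_iff]
    constructor
    · rintro ⟨h1, h2⟩
      exact ⟨⟨Ne.symm h2, (h y).symm⟩, Ne.symm h1⟩
    · rintro ⟨⟨h1, -⟩, h2⟩
      exact ⟨Ne.symm h2, Ne.symm h1⟩

theorem aux_univ {G : Type*} [Group G] [Finite G] (hnc : ¬ IsCyclic G) {b : G} (hb : b ≠ 1)
    (hU : ∀ y : G, y ∈ Subgroup.zpowers b ∨ b ∈ Subgroup.zpowers y) :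
    ∃ n : ℕ, 3 ≤ n ∧ Nonempty (G ≃* QuaternionGroup (2 ^ (n - 2))) := by
  have hdvd : ∀ {x y : G}, x ∈ Subgroup.zpowers y → orderOf x ∣ orderOf y := by
    intro x y h
    exact orderOf_dvd_of_mem_zpowers h
  obtain ⟨p, k, hp, hk⟩ : ∃ p k : ℕ, p.Prime ∧ orderOf b = p ^ k := by
    by_contra! hcon
    apply hnc
    have hd : Nat.card G ∣ Nat.card (Subgroup.zpowers b) := by
      rw [Nat.dvd_iff_prime_pow_dvd_dvd]
      intro q l hq hql
      have : Fact q.Prime := ⟨hq⟩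
      obtain ⟨K, hK⟩ := Sylow.exists_subgroup_card_pow_prime q hql
      rw [← hK]
      apply Subgroup.card_dvd_of_le
      intro y hy
      rcases hU y with h | h
      · exact h
      exfalso
      have h1 : orderOf b ∣ q ^ l := by
        rw [← hK]
        exact (hdvd h).trans (Subgroup.orderOf_dvd_natCard K hy)
      obtain ⟨m, -, hm⟩ := (Nat.dvd_prime_pow hq).1 h1
      exact hcon q m hq hm
    have htop : Subgroup.zpowers b = ⊤ :=
      Subgroup.eq_top_of_le_card _ (Nat.le_of_dvd Nat.card_pos hd)
    exact ⟨b, fun x => (htop ▸ Subgroup.mem_top x : x ∈ Subgroup.zpowers b)⟩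
  have hpf : Fact p.Prime := ⟨hp⟩
  have hk0 : k ≠ 0 := by
    rintro rfl
    exact hb (orderOf_eq_one_iff.1 (by simpa using hk))
  have hG : IsPGroup p G := by
    rw [IsPGroup.iff_orderOf]
    intro g
    refine ⟨_, Nat.eq_prime_pow_of_unique_prime_dvd (orderOf_pos g).ne' ?_⟩
    intro q hq hqg
    have hh : orderOf (g ^ (orderOf g / q)) = q :=
      orderOf_pow_orderOf_div (orderOf_pos g).ne' hqg
    rcases hU (g ^ (orderOf g / q)) with h | h
    · have := hdvd h
      rw [hh, hk] at this
      exact (Nat.prime_dvd_prime_iff_eq hq hp).1 (hq.dvd_of_dvd_pow this)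
    · have := hdvd h
      rw [hh, hk] at this
      exact ((Nat.prime_dvd_prime_iff_eq hp hq).1 ((dvd_pow_self p hk0).trans this)).symm
  refine aux_main hG ?_ hnc
  have hord : ∀ h : G, h ^ p = 1 → h ≠ 1 → orderOf h = p := fun h h1 h2 => orderOf_eq_prime h1 h2
  have hin : ∀ h : G, h ^ p = 1 → h ∈ Subgroup.zpowers b := by
    intro h hh
    by_cases h1 : h = 1
    · rw [h1]; exact Subgroup.one_mem _
    rcases hU h with h2 | h2
    · exact h2
    have h3 := hord h hh h1
    have h4 : Subgroup.zpowers b = Subgroup.zpowers h := by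
      apply Subgroup.eq_of_le_of_card_ge (Subgroup.zpowers_le.2 h2)
      rw [Nat.card_zpowers, Nat.card_zpowers, h3, hk]
      exact Nat.le_self_pow hk0 p
    rw [h4]; exact Subgroup.mem_zpowers h
  obtain ⟨l, rfl⟩ : ∃ l, k = l + 1 := ⟨k - 1, by omega⟩
  have hinc : ∀ h : G, h ^ p = 1 → h ∈ Subgroup.zpowers (b ^ p ^ l) := by
    intro h hh
    obtain ⟨i, rfl⟩ := hin h hh
    have hh : (b ^ i) ^ p = 1 := hh
    rw [← zpow_natCast, ← zpow_mul, aux_dvd hk, pow_succ] at hh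
    obtain ⟨j, rfl⟩ := Int.dvd_of_mul_dvd_mul_right (by exact_mod_cast hp.ne_zero) hh
    refine ⟨j, ?_⟩
    show (b ^ p ^ l) ^ j = b ^ ((p : ℤ) ^ l * j)
    rw [zpow_mul, ← zpow_natCast b]; push_cast; rfl
  intro g w hw hg
  have hwc := hinc w (by rw [← hw]; exact pow_orderOf_eq_one w)
  have : Subgroup.zpowers w = Subgroup.zpowers (b ^ p ^ l) := by
    apply Subgroup.eq_of_le_of_card_ge (Subgroup.zpowers_le.2 hwc)
    rw [Nat.card_zpowers, Nat.card_zpowers, hw]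
    apply orderOf_le_of_pow_eq_one hp.pos
    rw [← pow_mul, ← pow_succ, ← hk, pow_orderOf_eq_one]
  rw [this]
  exact hinc g hg

theorem aux_mem_xa {N : ℕ} {i : ZMod (2 * N)} {q : QuaternionGroup N}
    (h : q ∈ Subgroup.zpowers (QuaternionGroup.xa i)) :
    q = 1 ∨ q = .xa i ∨ q = .a N ∨ q = .xa (i + N) := by
  obtain ⟨k, hk⟩ := h
  have hk : (QuaternionGroup.xa i) ^ k = q := hk
  have h4 : (QuaternionGroup.xa i) ^ (4 : ℤ) = 1 := by
    have := QuaternionGroup.xa_pow_four i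
    exact_mod_cast this
  have h2 : (QuaternionGroup.xa i) ^ (2 : ℤ) = .a N := by
    have := QuaternionGroup.xa_sq i
    exact_mod_cast this
  rw [← Int.mul_ediv_add_emod k 4, zpow_add, zpow_mul, h4, one_zpow, one_mul] at hk
  have hr : k % 4 = 0 ∨ k % 4 = 1 ∨ k % 4 = 2 ∨ k % 4 = 3 := by omega
  rcases hr with hr | hr | hr | hr <;> rw [hr] at hk
  · left; simpa using hk.symm
  · right; left; simpa using hk.symm
  · right; right; left; rw [← hk, h2]
  · right; right; right
    rw [← hk, show (3 : ℤ) = 1 + 2 by norm_num, zpow_add, zpow_one, h2, QuaternionGroup.xa_mul_a]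

theorem aux_mem_a {N : ℕ} {i : ZMod (2 * N)} {q : QuaternionGroup N}
    (h : q ∈ Subgroup.zpowers (QuaternionGroup.a i)) : ∃ j, q = .a j := by
  have : ∀ k : ℕ, ∃ j, (QuaternionGroup.a i) ^ k = .a j := by
    intro k
    induction k with
    | zero => exact ⟨0, rfl⟩
    | succ k ih =>
      obtain ⟨j, hj⟩ := ih
      exact ⟨j + i, by rw [pow_succ, hj, QuaternionGroup.a_mul_a]⟩
  obtain ⟨k, hk⟩ := h
  have hk : (QuaternionGroup.a i) ^ k = q := hk
  rcases Int.eq_nat_or_neg k with ⟨l, rfl | rfl⟩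
  · obtain ⟨j, hj⟩ := this l
    rw [zpow_natCast] at hk
    exact ⟨j, by rw [← hk, hj]⟩
  · obtain ⟨j, hj⟩ := this l
    rw [zpow_neg, zpow_natCast, hj] at hk
    exact ⟨-j, hk.symm⟩

theorem aux_quat_univ (k : ℕ) (hk : k ≠ 0) :
    {b : QuaternionGroup (2 ^ k) | b ≠ 1 ∧ ∀ y, y ∈ Subgroup.zpowers b ∨ b ∈ Subgroup.zpowers y}
      = {.a ((2 ^ k : ℕ) : ZMod (2 * 2 ^ k))} := by
  have hlt : (2 : ℕ) ≤ 2 ^ k := Nat.le_self_pow hk 2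
  have : NeZero (2 * 2 ^ k) := ⟨by positivity⟩
  ext b
  simp only [Set.mem_ofPred_eq, Set.mem_singleton_iff]
  constructor
  · rintro ⟨hb, hU⟩
    rcases b with i | i
    · rcases hU (.xa 0) with h | h
      · obtain ⟨j, hj⟩ := aux_mem_a h
        cases hj
      · rcases aux_mem_xa h with h | h | h | h
        · exact absurd h hb
        · cases h
        · exact h
        · cases h
    · exfalso
      have hgen : ∀ j : ZMod (2 * 2 ^ k), QuaternionGroup.xa (j + 1) ∉
          Subgroup.zpowers (QuaternionGroup.xa j) := by
        intro j h
        have h0 : (1 : ZMod (2 * 2 ^ k)) ≠ 0 := by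
          intro h
          have : ((1 : ℕ) : ZMod (2 * 2 ^ k)) = 0 := by simpa using h
          rw [ZMod.natCast_eq_zero_iff] at this
          have := Nat.le_of_dvd one_pos this
          omega
        rcases aux_mem_xa h with h | h | h | h
        · cases h
        · injection h with h
          exact h0 (by simpa using h)
        · cases h
        · injection h with h
          have h : ((1 : ℕ) : ZMod (2 * 2 ^ k)) = ((2 ^ k : ℕ) : ZMod (2 * 2 ^ k)) := by
            rw [Nat.cast_one]; exact add_left_cancel h
          rw [ZMod.natCast_eq_natCast_iff'] at h
          rw [Nat.mod_eq_of_lt (by omega), Nat.mod_eq_of_lt (by omega)] at h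
          omega
      rcases hU (.xa (i + 1)) with h | h
      · exact hgen i h
      · rcases hU (.xa (i - 1)) with h' | h'
        · have key : QuaternionGroup.xa (i - 1) ∈ Subgroup.zpowers (QuaternionGroup.xa (i) : QuaternionGroup (2 ^ k)) →
            QuaternionGroup.xa i ∈ Subgroup.zpowers (QuaternionGroup.xa (i - 1) : QuaternionGroup (2 ^ k)) := by
            intro h
            have : Subgroup.zpowers (QuaternionGroup.xa (i - 1) : QuaternionGroup (2 ^ k)) =
                Subgroup.zpowers (QuaternionGroup.xa i) := by
              apply Subgroup.eq_of_le_of_card_ge (Subgroup.zpowers_le.2 h)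
              rw [Nat.card_zpowers, Nat.card_zpowers, QuaternionGroup.orderOf_xa,
                QuaternionGroup.orderOf_xa]
            rw [this]; exact Subgroup.mem_zpowers _
          have := key h'
          exact hgen (i - 1) (by simpa using this)
        · exact hgen (i - 1) (by simpa using h')
  · rintro rfl
    constructor
    · rw [← QuaternionGroup.a_zero]
      intro h
      injection h with h
      rw [ZMod.natCast_eq_zero_iff] at h
      have := Nat.le_of_dvd (by omega) h
      omega
    · rintro (i | i)
      · by_cases hi : i = 0
        · left
          rw [hi, QuaternionGroup.a_zero]; exact Subgroup.one_mem _
        right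
        obtain ⟨v, hv⟩ : ∃ v : ℕ, (v : ZMod (2 * 2 ^ k)) = i := ⟨i.val, by simp⟩
        have hv0 : ¬ 2 ^ (k + 1) ∣ v := by
          intro h
          apply hi
          rw [← hv, ZMod.natCast_eq_zero_iff, ← pow_succ']
          exact h
        have hvne : v ≠ 0 := by rintro rfl; simp at hv0
        obtain ⟨s, m, hm, hvs⟩ := Nat.exists_eq_two_pow_mul_odd hvne
        have hs : s ≤ k := by
          by_contra hs
          exact hv0 (hvs ▸ (pow_dvd_pow 2 (by omega)).mul_right m)
        refine ⟨((2 ^ (k - s) : ℕ) : ℤ), ?_⟩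
        show (QuaternionGroup.a i) ^ (((2 ^ (k - s) : ℕ)) : ℤ) = _
        rw [zpow_natCast, ← hv, ← QuaternionGroup.a_one_pow, ← pow_mul,
          QuaternionGroup.a_one_pow]
        congr 1
        obtain ⟨c, rfl⟩ := hm
        have : v * 2 ^ (k - s) = 2 ^ k + (2 * 2 ^ k) * c := by
          have e : 2 ^ k = 2 ^ s * 2 ^ (k - s) := by rw [← pow_add]; congr 1; omega
          rw [hvs, e]; ring
        rw [this, Nat.cast_add, Nat.cast_mul, ZMod.natCast_self, zero_mul, add_zero]
      · right
        refine ⟨((2 : ℕ) : ℤ), ?_⟩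
        show (QuaternionGroup.xa i) ^ ((2 : ℕ) : ℤ) = _
        rw [zpow_natCast, QuaternionGroup.xa_sq]

theorem aux_transfer {G H : Type*} [Group G] [Group H] (e : G ≃* H) :
    (closedTwins (1 : G)).ncard = (closedTwins (1 : H)).ncard := by
  rw [aux_twins, aux_twins]
  have hz : ∀ x y : G, e x ∈ Subgroup.zpowers (e y) ↔ x ∈ Subgroup.zpowers y := by
    intro x y
    simp only [Subgroup.mem_zpowers_iff, ← map_zpow, e.injective.eq_iff]
  have : {b : H | b ≠ 1 ∧ ∀ y, y ∈ Subgroup.zpowers b ∨ b ∈ Subgroup.zpowers y} =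
      e '' {b : G | b ≠ 1 ∧ ∀ y, y ∈ Subgroup.zpowers b ∨ b ∈ Subgroup.zpowers y} := by
    ext b
    obtain ⟨b, rfl⟩ := e.surjective b
    rw [e.injective.mem_set_image]
    simp only [Set.mem_ofPred_eq, e.surjective.forall, hz]
    simp
  rw [this, Set.ncard_image_of_injective _ e.injective]

theorem stmt6 {G : Type*} [Group G] [Finite G] (hnc : ¬ IsCyclic G) :
    ((∃ n : ℕ, 3 ≤ n ∧ Nonempty (G ≃* QuaternionGroup (2 ^ (n - 2)))) →
        Ncount (1 : G) = 2) ∧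
      (¬ (∃ n : ℕ, 3 ≤ n ∧ Nonempty (G ≃* QuaternionGroup (2 ^ (n - 2)))) →
        Ncount (1 : G) = 1) := by
  constructor
  · rintro ⟨n, hn, ⟨e⟩⟩
    rw [Ncount, aux_transfer e, aux_twins, aux_quat_univ (n - 2) (by omega), Set.ncard_singleton]
  · intro hno
    rw [Ncount, aux_twins]
    have : {b : G | b ≠ 1 ∧ ∀ y : G, y ∈ Subgroup.zpowers b ∨ b ∈ Subgroup.zpowers y} = ∅ := by
      ext b
      simp only [Set.mem_ofPred_eq, Set.mem_empty_iff_false, iff_false]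
      rintro ⟨hb, hU⟩
      exact hno (aux_univ hnc hb hU)
    rw [this, Set.ncard_empty]
end

section
/- Let G be a finite non-cyclic group and h ∈ G an element of prime-power order. Suppose there exists k ∈ G of non-prime-power order with ⟨h⟩ strictly contained in ⟨k⟩. Then the set of closed twins of h in the power graph equals gen(⟨h⟩)∖{h}, and hence N_h = φ(ord(h)). -/
def pcomp {G : Type*} [Group G] (a b : G) : Prop :=
  Subgroup.zpowers a ≤ Subgroup.zpowers b ∨ Subgroup.zpowers b ≤ Subgroup.zpowers a

theorem pcomp_symm {G : Type*} [Group G] {a b : G} (h : pcomp a b) : pcomp b a := Or.symm h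

theorem twin_iff {G : Type*} [Group G] (a b : G) :
    b ∈ closedTwins a ↔ a ≠ b ∧ ∀ x, pcomp a x ↔ pcomp b x := by
  constructor
  · rintro ⟨⟨hne, hc⟩, hN⟩
    refine ⟨hne, fun x => ?_⟩
    by_cases hxa : x = a
    · subst hxa
      exact ⟨fun _ => pcomp_symm hc, fun _ => Or.inl le_rfl⟩
    by_cases hxb : x = b
    · subst hxb
      exact ⟨fun _ => Or.inl le_rfl, fun _ => hc⟩
    have := Set.ext_iff.1 hN x
    simp only [Set.mem_diff, pnbhd, padj, Set.mem_setOf_eq, Set.mem_singleton_iff] at this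
    unfold pcomp
    have h1 : a ≠ x := fun e => hxa e.symm
    have h2 : b ≠ x := fun e => hxb e.symm
    tauto
  · rintro ⟨hne, hc⟩
    refine ⟨⟨hne, pcomp_symm ((hc a).1 (Or.inl le_rfl))⟩, ?_⟩
    ext x
    have := hc x
    simp only [Set.mem_diff, pnbhd, padj, Set.mem_setOf_eq, Set.mem_singleton_iff]
    unfold pcomp at this
    have h1 : a ≠ x ↔ ¬ x = a := ⟨fun e f => e f.symm, fun e f => e f.symm⟩
    have h2 : b ≠ x ↔ ¬ x = b := ⟨fun e f => e f.symm, fun e f => e f.symm⟩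
    tauto

theorem ord_dvd {G : Type*} [Group G] {a b : G}
    (h : Subgroup.zpowers a ≤ Subgroup.zpowers b) : orderOf a ∣ orderOf b := by
  exact orderOf_dvd_of_mem_zpowers (h (Subgroup.mem_zpowers a))

theorem eq_of_ord {G : Type*} [Group G] [Finite G] {a b : G}
    (h : Subgroup.zpowers a ≤ Subgroup.zpowers b) (ho : orderOf b ∣ orderOf a) :
    Subgroup.zpowers a = Subgroup.zpowers b := by
  apply Subgroup.eq_of_le_of_card_ge h
  rw [Nat.card_zpowers, Nat.card_zpowers]
  exact Nat.le_of_dvd (orderOf_pos a) ho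

theorem sep {G : Type*} [Group G] [Finite G] {c d y : G} {p q s t : ℕ}
    (hp : p.Prime) (hq : q.Prime) (hpq : q ≠ p) (hc : orderOf c = p ^ s) (hd : orderOf d = p ^ t)
    (hy : orderOf y = q) (hcy : Commute c y)
    (hcd : Subgroup.zpowers c < Subgroup.zpowers d) (H : ∀ x, pcomp c x ↔ pcomp d x) : False := by
  have cop : ∀ n, Nat.Coprime (p ^ n) q := fun n =>
    Nat.Coprime.pow_left n ((Nat.coprime_primes hp hq).2 hpq.symm)
  have ho : orderOf (c * y) = p ^ s * q := by
    rw [hcy.orderOf_mul_eq_mul_orderOf_of_coprime (by rw [hc, hy]; exact cop s), hc, hy]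
  have hle : Subgroup.zpowers c ≤ Subgroup.zpowers (c * y) := by
    have e : (c * y) ^ q = c ^ q := by
      rw [hcy.mul_pow, ← hy, pow_orderOf_eq_one, mul_one]
    have e2 : Subgroup.zpowers (c ^ q) = Subgroup.zpowers c := by
      apply eq_of_ord (Subgroup.zpowers_le.2 (Subgroup.npow_mem_zpowers c q))
      rw [Nat.Coprime.orderOf_pow (by rw [hc]; exact cop s)]
    rw [← e2, ← e]
    exact Subgroup.zpowers_le.2 (Subgroup.npow_mem_zpowers _ q)
  rcases (H (c * y)).1 (Or.inl hle) with h1 | h1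
  · have := ord_dvd h1
    rw [ho, hd] at this
    have h2 := (cop t).dvd_of_dvd_mul_right this
    rw [← hc, ← hd] at h2
    exact hcd.ne (eq_of_ord hcd.le h2)
  · have := ord_dvd h1
    rw [ho, hd] at this
    have h2 : q ∣ p ^ t := (Dvd.intro_left _ rfl).trans this
    exact hpq ((Nat.prime_dvd_prime_iff_eq hq hp).1 (hq.dvd_of_dvd_pow h2))

theorem exq {G : Type*} [Group G] [Finite G] {k : G} {p : ℕ}
    (hk : ¬ ∃ s, orderOf k = p ^ s) :
    ∃ q y, q.Prime ∧ q ≠ p ∧ orderOf y = q ∧ y ∈ Subgroup.zpowers k := by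
  by_contra hcon
  apply hk
  refine ⟨_, Nat.eq_prime_pow_of_unique_prime_dvd (orderOf_pos k).ne' (fun {d} hd hdk => ?_)⟩
  by_contra hne
  exact hcon ⟨d, _, hd, hne, orderOf_pow_orderOf_div (orderOf_pos k).ne' hdk,
    Subgroup.npow_mem_zpowers _ _⟩

theorem comm_of_mem {G : Type*} [Group G] {k a b : G} (ha : a ∈ Subgroup.zpowers k)
    (hb : b ∈ Subgroup.zpowers k) : Commute a b := by
  obtain ⟨m, rfl⟩ := Subgroup.mem_zpowers_iff.1 ha
  obtain ⟨n, rfl⟩ := Subgroup.mem_zpowers_iff.1 hb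
  exact Commute.zpow_zpow_self k m n

theorem gen_card {G : Type*} [Group G] [Finite G] (h : G) :
    {b : G | Subgroup.zpowers b = Subgroup.zpowers h}.ncard = Nat.totient (orderOf h) := by
  classical
  have := Fintype.ofFinite G
  have e : {b : G | Subgroup.zpowers b = Subgroup.zpowers h} =
      Subtype.val '' {x : Subgroup.zpowers h | orderOf x = orderOf h} := by
    ext b
    simp only [Set.mem_setOf_eq, Set.mem_image]
    constructor
    · intro hb
      refine ⟨⟨b, hb ▸ Subgroup.mem_zpowers b⟩, ?_, rfl⟩
      rw [Subgroup.orderOf_mk, ← Nat.card_zpowers, hb, Nat.card_zpowers]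
    · rintro ⟨x, hx, rfl⟩
      apply eq_of_ord (Subgroup.zpowers_le.2 x.2)
      rw [Subgroup.orderOf_coe, hx]
  rw [e, Set.ncard_image_of_injective _ Subtype.val_injective]
  have := IsCyclic.card_orderOf_eq_totient (α := Subgroup.zpowers h) (d := orderOf h)
    (by rw [← Nat.card_zpowers h]; simp)
  rw [← this, ← Set.ncard_coe_finset]
  simp

theorem stmt8 {G : Type*} [Group G] [Finite G] (hnc : ¬ IsCyclic G)
    (h : G) (hh : IsPrimePow (orderOf h))
    (hex : ∃ k : G, ¬ (∃ q s : ℕ, q.Prime ∧ orderOf k = q ^ s) ∧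
      Subgroup.zpowers h < Subgroup.zpowers k) :
    closedTwins h = {b : G | Subgroup.zpowers b = Subgroup.zpowers h} \ {h} ∧
      Ncount h = Nat.totient (orderOf h) := by
  obtain ⟨k, hk, hhk⟩ := hex
  obtain ⟨p, r, hp', hr, hpr⟩ := hh
  have hp : p.Prime := hp'.nat_prime
  have main : closedTwins h = {b : G | Subgroup.zpowers b = Subgroup.zpowers h} \ {h} := by
    ext b
    rw [twin_iff]
    simp only [Set.mem_diff, Set.mem_setOf_eq, Set.mem_singleton_iff]
    constructor
    · rintro ⟨hne, H⟩
      refine ⟨?_, fun e => hne e.symm⟩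
      by_contra hb
      obtain ⟨q, y, hq, hqp, hy, hyk⟩ := exq (k := k) (p := p) (fun ⟨s, hs⟩ => hk ⟨p, s, hp, hs⟩)
      have hhk' : h ∈ Subgroup.zpowers k := hhk.le (Subgroup.mem_zpowers h)
      rcases (H b).2 (Or.inl le_rfl) with hle | hle
      · by_cases hbp : ∃ s, orderOf b = p ^ s
        · obtain ⟨s, hs⟩ := hbp
          exact sep hp hq hqp hpr.symm hs hy (comm_of_mem hhk' hyk)
            (lt_of_le_of_ne hle (Ne.symm hb)) H
        · obtain ⟨q', z, hq', hqp', hz, hzb⟩ := exq hbp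
          rcases (H z).2 (Or.inr (Subgroup.zpowers_le.2 hzb)) with h1 | h1
          · have := ord_dvd h1
            rw [← hpr, hz] at this
            exact hqp' ((Nat.prime_dvd_prime_iff_eq hp hq').1
              ((dvd_pow_self p hr.ne').trans this)).symm
          · have := ord_dvd h1
            rw [← hpr, hz] at this
            exact hqp' ((Nat.prime_dvd_prime_iff_eq hq' hp).1 (hq'.dvd_of_dvd_pow this))
      · obtain ⟨s, -, hs⟩ := (Nat.dvd_prime_pow hp).1 (hpr ▸ ord_dvd hle)
        exact sep hp hq hqp hs hpr.symm hy
          (comm_of_mem (hhk.le (hle (Subgroup.mem_zpowers b))) hyk)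
          (lt_of_le_of_ne hle hb) (fun x => (H x).symm)
    · rintro ⟨hb, hne⟩
      refine ⟨fun e => hne e.symm, fun x => ?_⟩
      unfold pcomp
      rw [hb]
  refine ⟨main, ?_⟩
  rw [Ncount, main, Set.ncard_diff_singleton_add_one (by simp) (Set.toFinite _), gen_card]
end

section
/- Let G be a finite non-cyclic group in which every element has prime-power order (an EPPO group) that is not a generalized quaternion 2-group. Then the power graph and enhanced power graph of G coincide, and the identity is the unique universal vertex of the power graph (so N_e = 1). -/
theorem nt_solve (p n : ℕ) (m u : ℤ) (hpm : (p : ℤ) ∣ m)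
    (hu : IsCoprime u (p : ℤ)) : ∃ i : ℤ, ((p : ℤ) ^ n) ∣ m + i * (p * u) := by
  obtain ⟨m', rfl⟩ := hpm
  obtain ⟨c, d, hcd⟩ := hu.pow_right (n := n)
  refine ⟨-m' * c, p * m' * d, ?_⟩
  linear_combination (-(p:ℤ) * m') * hcd

theorem nt_dvd (p n : ℕ) (hp : p.Prime) (r m : ℤ) (h1 : ¬ ((p : ℤ) ^ n) ∣ r - 1)
    (hm : ((p : ℤ) ^ n) ∣ m * (r - 1)) : (p : ℤ) ∣ m := by
  by_contra h
  have hc : IsCoprime (p : ℤ) m :=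
    (Prime.coprime_iff_not_dvd (Nat.prime_iff_prime_int.mp hp)).2 h
  exact h1 ((hc.pow_left (m := n)).dvd_of_dvd_mul_left hm)

theorem nt_odd (p n : ℕ) (hp : p.Prime) (hodd : Odd p) (r m : ℤ)
    (hr : ((p : ℤ) ^ n) ∣ r ^ p - 1) (h1 : ¬ ((p : ℤ) ^ n) ∣ r - 1)
    (hm : ((p : ℤ) ^ n) ∣ m * (r - 1)) :
    ∃ i : ℤ, ((p : ℤ) ^ n) ∣ m + i * ∑ k ∈ Finset.range p, r ^ k := by
  have hpm := nt_dvd p n hp r m h1 hm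
  have hn : n ≠ 0 := by rintro rfl; simp at h1
  have hp1 : (p : ℤ) ∣ r ^ p - 1 := (dvd_pow_self _ hn).trans hr
  have := Fact.mk hp
  have hpr : (p : ℤ) ∣ r - 1 := by
    rw [← ZMod.intCast_zmod_eq_zero_iff_dvd] at hp1 ⊢
    push_cast at hp1 ⊢
    rwa [ZMod.pow_card] at hp1
  obtain ⟨t, ht⟩ := hpr
  obtain ⟨w, hw⟩ := odd_sq_dvd_geom_sum₂_sub (R := ℤ) (a := 1) (b := t) hodd
  have hS : ∑ k ∈ Finset.range p, r ^ k = p * (1 + p * w) := by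
    have : r = 1 + p * t := by linarith
    rw [this]
    simp only [one_pow, mul_one] at hw
    linear_combination hw
  rw [hS]
  exact nt_solve p n m _ hpm ⟨1, -w, by ring⟩

theorem nt_two (n : ℕ) (r m : ℤ)
    (hr : ((2 : ℤ) ^ n) ∣ r ^ 2 - 1) (h1 : ¬ ((2 : ℤ) ^ n) ∣ r - 1)
    (h2 : ¬ ((2 : ℤ) ^ n) ∣ r + 1)
    (hm : ((2 : ℤ) ^ n) ∣ m * (r - 1)) :
    ∃ i : ℤ, ((2 : ℤ) ^ n) ∣ m + i * (1 + r) := by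
  have hpm : (2 : ℤ) ∣ m := by exact_mod_cast nt_dvd 2 n Nat.prime_two r m (by simpa using h1) (by simpa using hm)
  obtain ⟨k, rfl⟩ : ∃ k, n = k + 1 :=
    Nat.exists_eq_succ_of_ne_zero (by rintro rfl; simp at h1)
  have hr2 : (2 : ℤ) ∣ r ^ 2 - 1 := (dvd_pow_self _ (by simp)).trans hr
  have hodd : r % 2 = 1 := by
    rcases Int.emod_two_eq_zero_or_one r with h | h
    · obtain ⟨s, rfl⟩ : (2:ℤ) ∣ r := Int.dvd_of_emod_eq_zero h
      exfalso
      have : (2*s)^2 = 2 * (2 * s^2) := by ring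
      omega
    · exact h
  have h4 : r % 4 = 1 ∨ r % 4 = 3 := by omega
  rcases h4 with h4 | h4
  · obtain ⟨s, hs⟩ : ∃ s, r = 4 * s + 1 := ⟨r / 4, by omega⟩
    have := nt_solve 2 (k+1) m (2 * s + 1) (by exact_mod_cast hpm) ⟨1, -s, by push_cast; ring⟩
    obtain ⟨i, hi⟩ := this
    refine ⟨i, ?_⟩
    push_cast at hi
    rw [hs]
    convert hi using 1
    ring
  · obtain ⟨s, hs⟩ : ∃ s, r = 4 * s + 3 := ⟨r / 4, by omega⟩
    have hc : IsCoprime ((2:ℤ)^k) (2 * s + 1) := IsCoprime.pow_left ⟨-s, 1, by ring⟩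
    have hr' : (2:ℤ)^k ∣ r + 1 := by
      have : (2:ℤ)^k * 2 ∣ ((2*s+1) * (r+1)) * 2 := by
        rw [← pow_succ]; convert hr using 1; rw [hs]; ring
      exact hc.dvd_of_dvd_mul_left ((mul_dvd_mul_iff_right two_ne_zero).1 this)
    have hm' : (2:ℤ)^k ∣ m := by
      have : (2:ℤ)^k * 2 ∣ (m * (2*s+1)) * 2 := by
        rw [← pow_succ]; convert hm using 1; rw [hs]; ring
      exact hc.dvd_of_dvd_mul_right ((mul_dvd_mul_iff_right two_ne_zero).1 this)
    obtain ⟨c, hc⟩ := hr'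
    obtain ⟨d, hd⟩ := hm'
    have hco : c % 2 = 1 := by
      by_contra h
      apply h2
      obtain ⟨e, rfl⟩ : (2:ℤ) ∣ c := by omega
      exact ⟨e, by rw [hc]; ring⟩
    obtain ⟨c', rfl⟩ : ∃ c', c = 2 * c' + 1 := ⟨c / 2, by omega⟩
    refine ⟨-d, -d * c', ?_⟩
    rw [add_comm 1 r, hc, hd]; ring

theorem mul_zpow_conj {G : Type*} [Group G] {g x : G} {r : ℤ} (h : g * x = x * g ^ r) (i : ℤ) (k : ℕ) :
    g ^ i * x ^ k = x ^ k * g ^ (i * r ^ k) := by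
  have h1 : ∀ i : ℤ, g ^ i * x = x * g ^ (i * r) := by
    intro i
    have : SemiconjBy x (g ^ r) g := h.symm
    have := this.zpow_right i
    rw [← zpow_mul, mul_comm] at this
    exact this.eq.symm
  induction k with
  | zero => simp
  | succ k ih => rw [pow_succ, ← mul_assoc, ih, mul_assoc, h1, ← mul_assoc, ← pow_succ, mul_assoc, ← pow_succ]

theorem pow_formula {G : Type*} [Group G] {g x : G} {r : ℤ} (h : g * x = x * g ^ r) (i : ℤ) (k : ℕ) :
    (x * g ^ i) ^ k = x ^ k * g ^ (i * ∑ j ∈ Finset.range k, r ^ j) := by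
  induction k with
  | zero => simp
  | succ k ih =>
    rw [pow_succ', ih, mul_assoc, ← mul_assoc (g ^ i), mul_zpow_conj h, Finset.sum_range_succ, mul_add,
      zpow_add, pow_succ', mul_assoc, mul_assoc, ← zpow_add, ← zpow_add, add_comm]

/-- A nontrivial normal subgroup of a finite `p`-group contains a nontrivial central element. -/
theorem exists_central {Q : Type*} [Group Q] [Finite Q] {p : ℕ} [Fact p.Prime] (hQ : IsPGroup p Q)
    (N : Subgroup Q) [N.Normal] {y : Q} (hy : y ∈ N) (hy1 : y ≠ 1) :
    ∃ z ∈ N, z ≠ 1 ∧ ∀ h : Q, h * z = z * h := by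
  have hC : IsPGroup p (ConjAct Q) := hQ
  have hd : p ∣ Nat.card N := by
    have hn : Nontrivial N := ⟨⟨y, hy⟩, 1, fun h => hy1 (congrArg Subtype.val h)⟩
    rcases (hQ.to_subgroup N).card_eq_or_dvd with h | h
    · exact absurd h (Finite.one_lt_card).ne'
    · exact h
  obtain ⟨b, hb, hb1⟩ := hC.exists_fixed_point_of_prime_dvd_card_of_fixed_point N hd
    (a := 1) (by intro g; simp)
  refine ⟨b, b.2, fun h => hb1 (Subtype.ext h.symm), fun h => ?_⟩
  have := congrArg Subtype.val (hb (ConjAct.toConjAct h))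
  rw [ConjAct.Subgroup.val_conj_smul, ConjAct.smul_def] at this
  simp at this
  exact mul_inv_eq_iff_eq_mul.1 this

/-- Recognition of quaternion groups. -/
theorem quat_iso {G : Type*} [Group G] {N : ℕ} (g x : G) (ho : orderOf g = 2 * N)
    (hx : x ∉ Subgroup.zpowers g) (hall : ∀ y, y ∉ Subgroup.zpowers g → x⁻¹ * y ∈ Subgroup.zpowers g)
    (hgx : g * x = x * g ^ (-1 : ℤ)) (hx2 : x ^ 2 = g ^ (N : ℤ)) :
    Nonempty (G ≃* QuaternionGroup N) := by
  have hφ : ∀ k : ℤ, g ^ (((k : ZMod (2 * N)).cast : ℤ)) = g ^ k := by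
    intro k
    rw [ZMod.coe_intCast, ← ho, zpow_mod_orderOf]
  have hrep : ∀ i : ZMod (2 * N), ∃ k : ℤ, (k : ZMod (2 * N)) = i := ZMod.intCast_surjective
  have hcomm : ∀ i : ℤ, g ^ i * x = x * g ^ (-i) := fun i => by
    simpa using mul_zpow_conj hgx i 1
  let F : QuaternionGroup N → G := fun q => match q with
    | .a i => g ^ (i.cast : ℤ)
    | .xa i => x * g ^ (i.cast : ℤ)
  have Fa : ∀ k : ℤ, F (.a k) = g ^ k := hφ
  have Fx : ∀ k : ℤ, F (.xa k) = x * g ^ k := fun k => congrArg (x * ·) (hφ k)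
  have hmul : ∀ u v, F (u * v) = F u * F v := by
    rintro (i | i) (j | j) <;> obtain ⟨i, rfl⟩ := hrep i <;> obtain ⟨j, rfl⟩ := hrep j
    · rw [QuaternionGroup.a_mul_a, ← Int.cast_add, Fa, Fa, Fa, zpow_add]
    · rw [QuaternionGroup.a_mul_xa, ← Int.cast_sub, Fx, Fx, Fa, ← mul_assoc, hcomm, mul_assoc,
        ← zpow_add, neg_add_eq_sub]
    · rw [QuaternionGroup.xa_mul_a, ← Int.cast_add, Fx, Fx, Fa, zpow_add, mul_assoc]
    · rw [QuaternionGroup.xa_mul_xa, ← Int.cast_natCast (R := ZMod (2 * N)), ← Int.cast_add, ← Int.cast_sub, Fx, Fx, Fa,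
        mul_assoc, ← mul_assoc _ x, hcomm, mul_assoc, ← zpow_add, ← mul_assoc, ← sq, hx2,
        ← zpow_add]
      congr 1; ring
  let Fh : QuaternionGroup N →* G := MonoidHom.mk' F hmul
  have hinj : Function.Injective Fh := by
    rw [injective_iff_map_eq_one]
    rintro (i | i) h <;> obtain ⟨i, rfl⟩ := hrep i
    · have h' : g ^ i = 1 := (Fa i).symm.trans h
      rw [← orderOf_dvd_iff_zpow_eq_one, ho] at h'
      rw [(ZMod.intCast_zmod_eq_zero_iff_dvd i (2 * N)).2 h', QuaternionGroup.a_zero]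
    · have h' : x * g ^ i = 1 := (Fx i).symm.trans h
      exact absurd ⟨-i, by simp [eq_inv_of_mul_eq_one_left h']⟩ hx
  have hsurj : Function.Surjective Fh := by
    intro y
    by_cases hy : y ∈ Subgroup.zpowers g
    · obtain ⟨k, rfl⟩ := hy
      exact ⟨.a k, Fa k⟩
    · obtain ⟨k, hk⟩ := hall y hy
      refine ⟨.xa k, (Fx k).trans ?_⟩
      simp only at hk
      rw [hk]; group
  exact ⟨(MulEquiv.ofBijective Fh ⟨hinj, hsurj⟩).symm⟩

/-- A `g` with `⟨g⟩` normal and self-centralizing. -/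
theorem exists_selfcentralizing {G : Type*} [Group G] [Finite G] {p : ℕ} [Fact p.Prime]
    (hG : IsPGroup p G)
    (hH : ∀ y y' : G, y ^ p = 1 → y' ≠ 1 → y ∈ Subgroup.zpowers y') :
    ∃ g : G, (Subgroup.zpowers g).Normal ∧ ∀ y, y * g = g * y → y ∈ Subgroup.zpowers g := by
  have hp : p.Prime := Fact.out
  obtain ⟨g, hgN, hmax⟩ := Set.exists_max_image {g : G | (Subgroup.zpowers g).Normal} orderOf
    (Set.toFinite _) ⟨1, by
      show (Subgroup.zpowers (1 : G)).Normal
      rw [Subgroup.zpowers_one_eq_bot]; infer_instance⟩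
  have hgN' : (Subgroup.zpowers g).Normal := hgN
  refine ⟨g, hgN, fun y₀ hy₀ => ?_⟩
  by_contra hy₀A
  let A := Subgroup.zpowers g
  let π := QuotientGroup.mk' A
  let C : Subgroup G := Subgroup.centralizer (A : Set G)
  have hCN : C.Normal := inferInstance
  have hDN : (C.map π).Normal := hCN.map π (QuotientGroup.mk'_surjective A)
  have memC : ∀ y, y * g = g * y → y ∈ C := by
    intro y hy
    rw [Subgroup.mem_centralizer_iff]
    rintro _ ⟨k, rfl⟩
    exact ((show Commute y g from hy).zpow_right k).eq.symm
  obtain ⟨z, hzD, hz1, hzc⟩ := exists_central (hG.to_quotient A) (C.map π)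
    (y := π y₀) ⟨y₀, memC _ hy₀, rfl⟩ (by
      intro h; exact hy₀A ((QuotientGroup.eq_one_iff y₀).1 h))
  -- replace by an element of order p
  obtain ⟨s, hs⟩ := IsPGroup.iff_orderOf.1 (hG.to_quotient A) z
  have hs0 : s ≠ 0 := by
    rintro rfl
    simp at hs
    exact hz1 hs
  obtain ⟨t, rfl⟩ := Nat.exists_eq_succ_of_ne_zero hs0
  obtain ⟨w, hwC, hwz⟩ := hzD
  set y := w ^ p ^ t with hy
  have hyC : y ∈ C := C.pow_mem hwC _
  have hπy : π y = z ^ p ^ t := by rw [hy, map_pow, hwz]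
  have hyA : y ∉ A := by
    intro h
    have h1 : π y = 1 := (QuotientGroup.eq_one_iff y).2 h
    rw [hπy, ← orderOf_dvd_iff_pow_eq_one, hs] at h1
    exact absurd (Nat.le_of_dvd (pow_pos hp.pos _) h1)
      (not_le.2 (Nat.pow_lt_pow_right hp.one_lt (Nat.lt_succ_self t)))
  have hypA : y ^ p ∈ A := by
    refine (QuotientGroup.eq_one_iff (y ^ p)).1 ?_
    change π (y ^ p) = 1
    rw [map_pow, hπy, ← pow_mul, ← pow_succ, ← hs, pow_orderOf_eq_one]
  have hycomm : Commute y g := by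
    have := (Subgroup.mem_centralizer_iff.1 hyC) g (Subgroup.mem_zpowers g)
    exact this.symm
  obtain ⟨m, hm⟩ := hypA
  simp only at hm
  -- g is a power of y
  have hgy : g ∈ Subgroup.zpowers y := by
    by_cases hg1 : g = 1
    · rw [hg1]; exact one_mem _
    by_cases hpm : (p : ℤ) ∣ m
    · exfalso
      obtain ⟨j, rfl⟩ := hpm
      have h1 : (y * g ^ (-j)) ^ p = 1 := by
        rw [(hycomm.zpow_right (-j)).mul_pow, ← hm, ← zpow_natCast, ← zpow_mul, ← zpow_add]
        rw [show (p:ℤ) * j + -j * p = 0 by ring, zpow_zero]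
      have h2 := hH _ g h1 hg1
      exact hyA ((Subgroup.mul_mem_cancel_right A ((Subgroup.zpowers g).zpow_mem (Subgroup.mem_zpowers g) _)).1 h2)
    · obtain ⟨e, he⟩ := IsPGroup.iff_orderOf.1 hG g
      have hc : IsCoprime m ((p : ℤ) ^ e) :=
        (((Prime.coprime_iff_not_dvd (Nat.prime_iff_prime_int.mp hp)).2 hpm).symm).pow_right
      obtain ⟨c, d, hcd⟩ := hc
      have : g = (y ^ p) ^ c := by
        rw [← hm, ← zpow_mul]
        have h3 : m * c = 1 + (orderOf g : ℤ) * (-d) := by rw [he]; push_cast; linarith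
        rw [h3, zpow_add, zpow_mul g (orderOf g : ℤ)]
        simp
      rw [this]
      exact zpow_mem (pow_mem (Subgroup.mem_zpowers y) _) _
  have hAy : A ≤ Subgroup.zpowers y := by
    rwa [Subgroup.zpowers_le]
  have hyN : (Subgroup.zpowers y).Normal := by
    constructor
    rintro _ ⟨k, rfl⟩ h
    have h1 : h * y * h⁻¹ ∈ Subgroup.zpowers y := by
      have h2 : y⁻¹ * (h * y * h⁻¹) ∈ A := by
        refine (QuotientGroup.eq_one_iff _).1 ?_
        change π _ = 1
        have hc : Commute (π h) (π y) := by
          rw [hπy]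
          exact (show Commute (π h) z from hzc _).pow_right _
        rw [map_mul, map_mul, map_mul, hc.eq]
        simp
      have := mul_mem (Subgroup.mem_zpowers y) (hAy h2)
      simpa using this
    have := zpow_mem h1 k
    rwa [conj_zpow] at this
  have hle := hmax y hyN
  have : A = Subgroup.zpowers y := by
    apply Subgroup.eq_of_le_of_card_ge hAy
    rw [Nat.card_zpowers, Nat.card_zpowers]
    exact hle
  exact hyA (this ▸ Subgroup.mem_zpowers y)

/-- If `x ∉ ⟨g⟩`, `x ^ p ∈ ⟨g⟩`, then `p = 2` and `x` inverts `g`. -/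
theorem key_step {G : Type*} [Group G] [Finite G] {p : ℕ} [Fact p.Prime]
    (hH : ∀ y y' : G, y ^ p = 1 → y' ≠ 1 → y ∈ Subgroup.zpowers y')
    {g : G} {n : ℕ} (hn : orderOf g = p ^ n) (hgN : (Subgroup.zpowers g).Normal)
    (hgC : ∀ y, y * g = g * y → y ∈ Subgroup.zpowers g)
    {x : G} (hx : x ∉ Subgroup.zpowers g) (hxp : x ^ p ∈ Subgroup.zpowers g) :
    p = 2 ∧ g * x = x * g ^ (-1 : ℤ) ∧ ¬ ((2 : ℤ) ^ n ∣ 2) ∧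
      ∃ m : ℤ, x ^ 2 = g ^ m ∧ (2 : ℤ) ^ n ∣ 2 * m ∧ ¬ (2 : ℤ) ^ n ∣ m := by
  have hp : p.Prime := Fact.out
  have hz : ∀ a b : ℤ, g ^ a = g ^ b ↔ (p : ℤ) ^ n ∣ b - a := by
    intro a b
    rw [← Nat.cast_pow, ← hn, orderOf_dvd_iff_zpow_eq_one, zpow_sub, mul_inv_eq_one, eq_comm]
  obtain ⟨r, hr⟩ : ∃ r : ℤ, g * x = x * g ^ r := by
    obtain ⟨r, hr⟩ := hgN.conj_mem g (Subgroup.mem_zpowers g) x⁻¹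
    refine ⟨r, ?_⟩
    simp only at hr
    rw [hr]; group
  obtain ⟨m, hm⟩ := hxp
  simp only at hm
  have h1 : ¬ (p : ℤ) ^ n ∣ r - 1 := by
    intro h
    have := (hz 1 r).2 h
    rw [zpow_one] at this
    exact hx (hgC x (by rw [hr, ← this]))
  have hrp : (p : ℤ) ^ n ∣ r ^ p - 1 := by
    rw [← hz]
    have := mul_zpow_conj hr 1 p
    rw [← hm, ← zpow_add, ← zpow_add, add_comm, zpow_add, zpow_add] at this
    simpa using this
  have hmr : (p : ℤ) ^ n ∣ m * (r - 1) := by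
    rw [mul_sub, mul_one, ← hz]
    have := mul_zpow_conj hr m 1
    rw [hm, pow_one, pow_one, ← pow_succ, pow_succ'] at this
    rw [hm]; exact mul_left_cancel this
  have hg1 : g ≠ 1 := by
    rintro rfl
    exact hx (hgC x (by simp))
  have hno : ¬ ∃ i : ℤ, (p : ℤ) ^ n ∣ m + i * ∑ k ∈ Finset.range p, r ^ k := by
    rintro ⟨i, hi⟩
    have h2 : (x * g ^ i) ^ p = 1 := by
      rw [pow_formula hr, ← hm, ← zpow_add, ← zpow_zero g, hz]
      rw [zero_sub]; exact hi.neg_right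
    exact hx ((Subgroup.mul_mem_cancel_right _ (zpow_mem (Subgroup.mem_zpowers g) _)).1
      (hH _ g h2 hg1))
  have hp2 : p = 2 := by
    by_contra h
    exact hno (nt_odd p n hp (hp.odd_of_ne_two h) r m hrp h1 hmr)
  subst hp2
  simp only [Nat.cast_ofNat, Finset.sum_range_succ, Finset.sum_range_zero, zero_add, pow_zero, pow_one] at hno hrp h1 hmr hz
  have hr1 : (2 : ℤ) ^ n ∣ r + 1 := by
    by_contra h2
    exact hno (nt_two n r m hrp h1 h2 hmr)
  refine ⟨rfl, ?_, ?_, m, hm.symm, ?_, ?_⟩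
  · rw [hr, (hz r (-1)).2 ?_]
    rw [show -1 - r = -(r + 1) by ring]
    exact hr1.neg_right
  · intro h
    apply h1
    rw [show r - 1 = (r + 1) - 2 by ring]
    exact dvd_sub hr1 h
  · rw [show 2 * m = m * (r + 1) - m * (r - 1) by ring]
    exact dvd_sub (hr1.mul_left m) hmr
  · intro h
    exact hno ⟨0, by simpa using h⟩

theorem classification {G : Type*} [Group G] [Finite G] (hnc : ¬ IsCyclic G) {p : ℕ} [Fact p.Prime]
    (hG : IsPGroup p G)
    (hH : ∀ y y' : G, y ^ p = 1 → y' ≠ 1 → y ∈ Subgroup.zpowers y') :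
    ∃ n : ℕ, Nonempty (G ≃* QuaternionGroup (2 ^ n)) := by
  obtain ⟨g, hgN, hgC⟩ := exists_selfcentralizing hG hH
  obtain ⟨n, hn⟩ := IsPGroup.iff_orderOf.1 hG g
  have key := fun {x : G} => key_step (x := x) hH hn hgN hgC
  obtain ⟨x₀, hx₀⟩ : ∃ x, x ∉ Subgroup.zpowers g := by
    by_contra! h
    exact hnc ⟨g, h⟩
  -- raising to p-powers
  have desc : ∀ x, x ∉ Subgroup.zpowers g → ∃ k, x ^ p ^ k ∉ Subgroup.zpowers g ∧
      (x ^ p ^ k) ^ p ∈ Subgroup.zpowers g := by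
    intro x hx
    classical
    have hex : ∃ k, x ^ p ^ k ∈ Subgroup.zpowers g := by
      obtain ⟨k, hk⟩ := hG x
      exact ⟨k, hk ▸ one_mem _⟩
    have h0 : Nat.find hex ≠ 0 := by
      intro h
      have := Nat.find_spec hex
      rw [h] at this
      simp at this
      exact hx this
    obtain ⟨k, hk⟩ := Nat.exists_eq_succ_of_ne_zero h0
    refine ⟨k, Nat.find_min hex (by omega), ?_⟩
    have := Nat.find_spec hex
    rw [hk] at this
    rwa [← pow_mul, ← pow_succ]
  obtain ⟨k₀, hk1, hk2⟩ := desc x₀ hx₀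
  obtain ⟨hp2, -, hn2, -⟩ := key hk1 hk2
  subst hp2
  have h2n : 2 ≤ n := by
    by_contra h
    have : n = 0 ∨ n = 1 := by omega
    rcases this with rfl | rfl <;> simp at hn2
  have hsq : ∀ x, x ∉ Subgroup.zpowers g → x ^ 2 ∈ Subgroup.zpowers g := by
    intro x hx
    obtain ⟨k, h1, h2⟩ := desc x hx
    rcases k with _ | k
    · simpa using h2
    exfalso
    obtain ⟨-, hinv, -, -⟩ := key h1 h2
    obtain ⟨r, hr⟩ := hgN.conj_mem g (Subgroup.mem_zpowers g) (x ^ 2 ^ k)⁻¹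
    simp only at hr
    have hr' : g * x ^ 2 ^ k = x ^ 2 ^ k * g ^ r := by rw [hr]; group
    have h3 := mul_zpow_conj hr' 1 2
    rw [← pow_mul, ← pow_succ, zpow_one, hinv, one_mul] at h3
    have h4 := mul_left_cancel h3
    have h5 : (2 : ℤ) ^ n ∣ r ^ 2 - (-1) := by
      have : ((2 ^ n : ℕ) : ℤ) ∣ r ^ 2 - (-1) := by
        rw [← hn, orderOf_dvd_iff_zpow_eq_one, zpow_sub, mul_inv_eq_one, h4]
      exact_mod_cast this
    have h6 : (4 : ℤ) ∣ r ^ 2 - (-1) := (show (4 : ℤ) = 2 ^ 2 by norm_num) ▸ (pow_dvd_pow 2 h2n).trans h5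
    rcases Int.even_or_odd' r with ⟨c, rfl | rfl⟩
    · have : (2 * c) ^ 2 = 4 * c ^ 2 := by ring
      omega
    · have : (2 * c + 1) ^ 2 = 4 * (c ^ 2 + c) + 1 := by ring
      omega
  obtain ⟨-, hinv, -, m, hm, hm2, hm3⟩ := key hx₀ (hsq _ hx₀)
  obtain ⟨l, rfl⟩ : ∃ l, n = l + 1 := ⟨n - 1, by omega⟩
  refine ⟨l, quat_iso g x₀ (by rw [hn, pow_succ']) hx₀ ?_ hinv ?_⟩
  · intro y hy
    obtain ⟨-, hinvy, -, -⟩ := key hy (hsq _ hy)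
    apply hgC
    rw [zpow_neg_one] at hinv hinvy
    have e1 : x₀⁻¹ * g = g⁻¹ * x₀⁻¹ := by
      have := congrArg (fun t => x₀⁻¹ * t * x₀⁻¹) hinv
      simpa [mul_assoc] using this
    have e2 : y * g = g⁻¹ * y := by
      have := congrArg (fun t => g⁻¹ * t * g) hinvy
      simpa [mul_assoc] using this
    have e3 : x₀⁻¹ * g⁻¹ = g * x₀⁻¹ := by
      have := congrArg (fun t => g * t * g⁻¹) e1
      simpa [mul_assoc] using this.symm
    rw [mul_assoc, e2, ← mul_assoc, e3, mul_assoc]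
  · rw [hm]
    obtain ⟨d, hd⟩ : (2 : ℤ) ^ l ∣ m := by
      rw [pow_succ'] at hm2
      exact (mul_dvd_mul_iff_left two_ne_zero).1 hm2
    have hdo : d % 2 = 1 := by
      by_contra h
      apply hm3
      obtain ⟨e, rfl⟩ : (2:ℤ) ∣ d := by omega
      exact ⟨e, by rw [hd]; ring⟩
    obtain ⟨e, rfl⟩ : ∃ e, d = 2 * e + 1 := ⟨d / 2, by omega⟩
    have : m = ((2 ^ l : ℕ) : ℤ) + (orderOf g : ℤ) * e := by
      rw [hn, hd]; push_cast; ring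
    rw [this, zpow_add, zpow_mul g (orderOf g : ℤ)]
    simp

theorem stmt19 {G : Type*} [Group G] [Finite G] (hnc : ¬ IsCyclic G)
    (heppo : ∀ a : G, ∃ q s : ℕ, q.Prime ∧ orderOf a = q ^ s)
    (hq : ∀ n : ℕ, ¬ Nonempty (G ≃* QuaternionGroup (2 ^ n))) :
    (∀ a b : G, padj a b ↔ eadj a b) ∧
      {a : G | ∀ b : G, b ≠ a → padj a b} = {1} ∧ Ncount (1 : G) = 1 := by
  -- subgroups of a cyclic group of prime power order form a chain
  have chain : ∀ a b c : G, a ∈ Subgroup.zpowers c → b ∈ Subgroup.zpowers c →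
      Subgroup.zpowers a ≤ Subgroup.zpowers b ∨ Subgroup.zpowers b ≤ Subgroup.zpowers a := by
    intro a b c ha hb
    obtain ⟨q, s, hqp, hs⟩ := heppo c
    have key : ∀ u v : G, u ∈ Subgroup.zpowers c → v ∈ Subgroup.zpowers c →
        orderOf u ∣ orderOf v → Subgroup.zpowers u ≤ Subgroup.zpowers v := by
      intro u v hu hv huv
      have h1 : Subgroup.zpowers u ≤ Subgroup.zpowers c := by rwa [Subgroup.zpowers_le]
      have h2 : Subgroup.zpowers v ≤ Subgroup.zpowers c := by rwa [Subgroup.zpowers_le]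
      obtain ⟨i, rfl⟩ := hu
      obtain ⟨j, rfl⟩ := mem_powers_iff_mem_zpowers.2 hv
      simp only at *
      rw [Subgroup.zpowers_le, Subgroup.mem_zpowers_iff]
      have hz : ∀ t : ℤ, c ^ t = 1 ↔ ((q ^ s : ℕ) : ℤ) ∣ t := by
        intro t; rw [← hs, orderOf_dvd_iff_zpow_eq_one]
      have h3 : (c ^ i) ^ orderOf (c ^ j) = 1 := orderOf_dvd_iff_pow_eq_one.1 huv
      have hoj : ∃ d e : ℤ, d * (j : ℤ) + e * (q ^ s : ℕ) = Int.gcd j (q ^ s : ℕ) :=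
        ⟨Int.gcdA j (q ^ s : ℕ), Int.gcdB j (q ^ s : ℕ), by rw [Int.gcd_eq_gcd_ab]; ring⟩
      obtain ⟨d, e, hde⟩ := hoj
      have h4 : c ^ ((Int.gcd j (q ^ s : ℕ) : ℕ) : ℤ) = (c ^ j) ^ d := by
        rw [← hde, zpow_add, (hz (e * (q ^ s : ℕ))).2 (dvd_mul_left _ _), mul_one, mul_comm, zpow_mul, zpow_natCast]
      -- order of c^j is q^s / gcd
      have h5 : (orderOf (c ^ j) : ℤ) * (Int.gcd j (q ^ s : ℕ) : ℤ) = (q ^ s : ℕ) := by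
        have : orderOf (c ^ j) = orderOf c / Nat.gcd (orderOf c) j := orderOf_pow c
        rw [hs, Nat.gcd_comm, ← Int.gcd_natCast_natCast] at this
        rw [this]
        have hd : Int.gcd j (q ^ s : ℕ) ∣ q ^ s := by
          exact_mod_cast Int.gcd_dvd_right j ((q ^ s : ℕ) : ℤ)
        exact_mod_cast Nat.div_mul_cancel hd
      have h6 : (Int.gcd j (q ^ s : ℕ) : ℤ) ∣ i := by
        rw [← zpow_natCast, ← zpow_mul, hz, ← h5, mul_comm] at h3
        exact (mul_dvd_mul_iff_right (by exact_mod_cast (orderOf_pos (c ^ j)).ne')).1 h3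
      obtain ⟨w, hw⟩ := h6
      exact ⟨d * w, by rw [hw, zpow_mul, zpow_mul, h4]⟩
    have ha' : orderOf a ∣ q ^ s := hs ▸ orderOf_dvd_of_mem_zpowers ha
    have hb' : orderOf b ∣ q ^ s := hs ▸ orderOf_dvd_of_mem_zpowers hb
    obtain ⟨i, -, hi⟩ := (Nat.dvd_prime_pow hqp).1 ha'
    obtain ⟨j, -, hj⟩ := (Nat.dvd_prime_pow hqp).1 hb'
    rcases le_total i j with h | h
    · exact Or.inl (key a b ha hb (by rw [hi, hj]; exact pow_dvd_pow q h))
    · exact Or.inr (key b a hb ha (by rw [hi, hj]; exact pow_dvd_pow q h))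
  have one_adj : ∀ b : G, b ≠ 1 → padj 1 b := fun b hb => ⟨hb.symm, Or.inl (by simp)⟩
  have univ : ∀ a : G, (∀ b : G, b ≠ a → padj a b) → a = 1 := by
    intro a ha
    by_contra ha1
    obtain ⟨q, s, hqp, hs⟩ := heppo a
    have := Fact.mk hqp
    have hcmp : ∀ b, Subgroup.zpowers a ≤ Subgroup.zpowers b ∨ b ∈ Subgroup.zpowers a := by
      intro b
      by_cases hb : b = a
      · left; rw [hb]
      · rcases (ha b hb).2 with h | h
        · exact Or.inl h
        · exact Or.inr (h (Subgroup.mem_zpowers b))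
    have hs0 : s ≠ 0 := by
      rintro rfl
      simp at hs
      exact ha1 hs
    have hG : IsPGroup q G := by
      rw [IsPGroup.iff_orderOf]
      intro b
      rcases hcmp b with h | h
      · obtain ⟨q', s', hq', hs'⟩ := heppo b
        have h1 : orderOf a ∣ orderOf b := orderOf_dvd_of_mem_zpowers (h (Subgroup.mem_zpowers a))
        have h2 : q ∣ q' ^ s' := by
          rw [← hs']
          exact (dvd_pow_self q hs0).trans (hs ▸ h1)
        have h3 := (Nat.prime_dvd_prime_iff_eq hqp hq').1 (hqp.dvd_of_dvd_pow h2)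
        exact ⟨s', h3 ▸ hs'⟩
      · have h1 : orderOf b ∣ q ^ s := hs ▸ orderOf_dvd_of_mem_zpowers h
        obtain ⟨i, -, hi⟩ := (Nat.dvd_prime_pow hqp).1 h1
        exact ⟨i, hi⟩
    -- order of elements of order q versus nontrivial ones
    have hcomp : ∀ y y' : G, y ^ q = 1 → y' ≠ 1 →
        (Subgroup.zpowers y ≤ Subgroup.zpowers y' ∨ Subgroup.zpowers y' ≤ Subgroup.zpowers y) →
        y ∈ Subgroup.zpowers y' := by
      intro y y' hy hy' h
      rcases h with h | h
      · exact h (Subgroup.mem_zpowers y)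
      · have h1 : Subgroup.zpowers y' = Subgroup.zpowers y := by
          apply Subgroup.eq_of_le_of_card_ge h
          rw [Nat.card_zpowers, Nat.card_zpowers]
          exact (Nat.le_of_dvd hqp.pos (orderOf_dvd_of_pow_eq_one hy)).trans
            (Nat.le_of_dvd (orderOf_pos y') (hG.dvd_orderOf hy'))
        rw [h1]; exact Subgroup.mem_zpowers y
    have hya : ∀ y, y ^ q = 1 → y ∈ Subgroup.zpowers a := by
      intro y hy
      rcases hcmp y with h | h
      · exact hcomp y a hy ha1 (Or.inr h)
      · exact h
    obtain ⟨n, hn⟩ := classification hnc hG (by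
      intro y y' hy hy'
      rcases hcmp y' with h | h
      · exact h (hya y hy)
      · exact hcomp y y' hy hy' (chain y y' a (hya y hy) h))
    exact hq n hn
  refine ⟨fun a b => ⟨?_, ?_⟩, ?_, ?_⟩
  · rintro ⟨hne, h | h⟩
    · exact ⟨hne, b, h (Subgroup.mem_zpowers a), Subgroup.mem_zpowers b⟩
    · exact ⟨hne, a, Subgroup.mem_zpowers a, h (Subgroup.mem_zpowers b)⟩
  · rintro ⟨hne, c, ha, hb⟩
    exact ⟨hne, chain a b c ha hb⟩
  · ext a
    simp only [Set.mem_ofPred_eq, Set.mem_singleton_iff]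
    constructor
    · exact univ a
    · rintro rfl; exact one_adj
  · have : closedTwins (1 : G) = ∅ := by
      rw [Set.eq_empty_iff_forall_notMem]
      rintro b ⟨hb, heq⟩
      refine hb.1 (univ b fun c hc => ?_).symm
      by_cases hc1 : c = 1
      · subst hc1
        exact ⟨hb.1.symm, Or.inr (by simp)⟩
      · have : c ∈ pnbhd (1 : G) \ {b} := ⟨one_adj c hc1, hc⟩
        rw [heq] at this
        exact this.1
    simp [Ncount, this]
end
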